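/- As n → ∞, log Q(n) is asymptotic to (2π/√3)·√(log(n)/log log(n)), i.e. the ratio log Q(n) / ((2π/√3)·√(log(n)/log log(n))) tends to 1. -/

import Mathlib

open Finset Filter Real

/-- `ell k` is the product of the first `k` primes, `ℓ_k = p_1 ⋯ p_k`. -/
noncomputable def ell (k : ℕ) : ℕ := ∏ i ∈ Finset.range k, Nat.nth Nat.Prime i

/-- `𝒬` is the set of positive integers expressible as `ℓ_1^{b_1} ⋯ ℓ_t^{b_t}`
for some `t ≥ 1` and non-negative integers `b_1, …, b_t`. -/
def QSet : Set ℕ :=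
  {q | ∃ t : ℕ, 1 ≤ t ∧ ∃ b : ℕ → ℕ, q = ∏ k ∈ Finset.range t, ell (k + 1) ^ b k}

/-- `Qfun n = |𝒬 ∩ [n]|`, the number of elements of `𝒬` that are at most `n`. -/
noncomputable def Qfun (n : ℕ) : ℕ := (QSet ∩ Set.Icc 1 n).ncard

/-! ### Growth of the primorials -/

lemma ell_pos (k : ℕ) : 0 < ell k :=
  Finset.prod_pos fun i _ => (Nat.prime_nth_prime i).pos

lemma two_pow_le_ell (k : ℕ) : 2 ^ k ≤ ell k := by
  unfold ell
  simpa using Finset.prod_le_prod' (s := Finset.range k) (f := fun _ => 2)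
    (g := fun i => Nat.nth Nat.Prime i) fun i _ => (Nat.prime_nth_prime i).two_le

lemma factorial_le_ell (k : ℕ) : k.factorial ≤ ell k := by
  rw [← Finset.prod_range_add_one_eq_factorial]
  exact Finset.prod_le_prod' fun i _ => (Nat.le_succ _).trans (Nat.add_two_le_nth_prime i)

lemma ell_le_nth_pow (k : ℕ) : ell k ≤ Nat.nth Nat.Prime k ^ k := by
  unfold ell
  simpa using Finset.prod_le_prod' (s := Finset.range k) (g := fun _ => Nat.nth Nat.Prime k)
    (f := fun i => Nat.nth Nat.Prime i) fun i hi =>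
      (Nat.nth_strictMono Nat.infinite_setOfPred_prime).monotone (Finset.mem_range.1 hi).le

lemma mul_log_two_le_log_ell (k : ℕ) : (k : ℝ) * Real.log 2 ≤ Real.log (ell k) := by
  rw [← Real.log_pow]
  exact Real.log_le_log (by positivity) (by exact_mod_cast two_pow_le_ell k)

lemma eventually_le_log_ell {ε : ℝ} (hε : 0 < ε) :
    ∀ᶠ k : ℕ in atTop, (1 - ε) * (k * Real.log k) ≤ Real.log (ell k) := by
  have h1 : ∀ᶠ k : ℕ in atTop, 1 / ε ≤ Real.log k :=
    (Real.tendsto_log_atTop.comp tendsto_natCast_atTop_atTop).eventually_ge_atTop _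
  filter_upwards [h1, eventually_ge_atTop 1] with k hk hk1
  have h2 := Stirling.le_log_factorial_stirling (n := k) (by omega)
  have h3 : Real.log k.factorial ≤ Real.log (ell k) :=
    Real.log_le_log (by exact_mod_cast k.factorial_pos) (by exact_mod_cast factorial_le_ell k)
  have h4 : 0 ≤ Real.log k := Real.log_natCast_nonneg k
  have h5 : 0 ≤ Real.log (2 * π) := Real.log_nonneg (by nlinarith [Real.pi_gt_three])
  have h6 : 1 ≤ Real.log k * ε := by rwa [div_le_iff₀ hε] at hk
  have h7 : (k : ℝ) * 1 ≤ k * (Real.log k * ε) := by gcongr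
  linarith

/-- Chebyshev's lower bound for the number of primes, in a weak form. -/
lemma eventually_rpow_le_primeCounting {ε : ℝ} (hε : 0 < ε) :
    ∀ᶠ n : ℕ in atTop, (n : ℝ) ^ (1 - ε) + 1 ≤ n.primeCounting := by
  have hlog : ∀ᶠ x : ℝ in atTop, Real.log x ≤ (1 / 8) * x ^ (min ε 1) := by
    have := (isLittleO_log_rpow_atTop (lt_min hε one_pos)).bound (show (0 : ℝ) < 1 / 8 by norm_num)
    filter_upwards [this, eventually_ge_atTop 1] with x hx hx1
    rw [Real.norm_of_nonneg (Real.log_nonneg hx1), Real.norm_of_nonneg (by positivity)] at hx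
    exact hx
  have hlog1 : ∀ᶠ x : ℝ in atTop, Real.log x ≤ (1 / 16) * x := by
    have := Real.isLittleO_log_id_atTop.bound (show (0 : ℝ) < 1 / 16 by norm_num)
    filter_upwards [this, eventually_ge_atTop 1] with x hx hx1
    rw [Real.norm_of_nonneg (Real.log_nonneg hx1), Real.norm_of_nonneg (by simp; linarith)] at hx
    exact hx
  filter_upwards [tendsto_natCast_atTop_atTop.eventually hlog,
    tendsto_natCast_atTop_atTop.eventually hlog1, eventually_ge_atTop 3] with n h1 h2 h3
  refine le_trans ?_ (Chebyshev.pi_ge n)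
  have hn : (3 : ℝ) ≤ n := by exact_mod_cast h3
  have hL : 0 < Real.log n := Real.log_pos (by linarith)
  rw [le_div_iff₀ hL]
  have h4 : Real.log ((n : ℝ) + 1) ≤ 2 * Real.log n := by
    rw [← Real.log_rpow (by linarith)]
    refine Real.log_le_log (by linarith) ?_
    norm_num
    nlinarith
  have h5 : (n : ℝ) ^ (1 - ε) * Real.log n ≤ 1 / 8 * n := by
    calc (n : ℝ) ^ (1 - ε) * Real.log n ≤ (n : ℝ) ^ (1 - ε) * (1 / 8 * (n : ℝ) ^ (min ε 1)) := by
          gcongr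
      _ = 1 / 8 * (n : ℝ) ^ (1 - ε + min ε 1) := by
          rw [Real.rpow_add (by linarith)]; ring
      _ ≤ 1 / 8 * (n : ℝ) ^ (1 : ℝ) := by
          gcongr
          · linarith
          · linarith [min_le_left ε 1]
      _ = _ := by rw [Real.rpow_one]
  have h6 := Real.log_two_gt_d9
  nlinarith

lemma primeCounting_nth_prime (k : ℕ) : (Nat.nth Nat.Prime k).primeCounting = k + 1 := by
  rw [Nat.primeCounting, Nat.primeCounting', Nat.count_succ, ← Nat.primeCounting',
    Nat.primeCounting'_nth_eq, if_pos (Nat.prime_nth_prime k)]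

lemma eventually_log_nth_prime_le {ε : ℝ} (hε : 0 < ε) :
    ∀ᶠ k : ℕ in atTop, (1 - ε) * Real.log (Nat.nth Nat.Prime k) ≤ Real.log k := by
  have hmono := Nat.nth_strictMono Nat.infinite_setOfPred_prime
  filter_upwards [hmono.tendsto_atTop.eventually (eventually_rpow_le_primeCounting hε)] with k hk
  have hp : (0 : ℝ) < Nat.nth Nat.Prime k := by exact_mod_cast (Nat.prime_nth_prime k).pos
  rw [primeCounting_nth_prime] at hk
  push_cast at hk
  rw [← Real.log_rpow hp]
  exact Real.log_le_log (by positivity) (by linarith)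

lemma eventually_log_ell_le {ε : ℝ} (hε : 0 < ε) :
    ∀ᶠ k : ℕ in atTop, Real.log (ell k) ≤ (1 + ε) * (k * Real.log k) := by
  have hδ : 0 < ε / (1 + ε) := by positivity
  filter_upwards [eventually_log_nth_prime_le hδ] with k hk
  have h1 : Real.log (ell k) ≤ k * Real.log (Nat.nth Nat.Prime k) := by
    rw [← Real.log_pow]
    exact Real.log_le_log (by exact_mod_cast ell_pos k) (by exact_mod_cast ell_le_nth_pow k)
  have h2 : Real.log (Nat.nth Nat.Prime k) ≤ (1 + ε) * Real.log k := by
    have : 1 - ε / (1 + ε) = 1 / (1 + ε) := by field_simp; ring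
    rw [this, one_div, inv_mul_le_iff₀ (by positivity)] at hk
    exact hk
  calc Real.log (ell k) ≤ k * Real.log (Nat.nth Nat.Prime k) := h1
    _ ≤ k * ((1 + ε) * Real.log k) := by gcongr
    _ = _ := by ring

/-! ### The sums `∑ -log (1 - exp (-s L_k))` as `s → 0` -/

/-- The function `x ↦ -log (1 - exp (-x))`. -/
noncomputable def boseLog (x : ℝ) : ℝ := -Real.log (1 - Real.exp (-x))

lemma hasSum_boseLog {x : ℝ} (hx : 0 < x) :
    HasSum (fun m : ℕ => Real.exp (-((m + 1) * x)) / (m + 1)) (boseLog x) := by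
  have h : |Real.exp (-x)| < 1 := by
    rw [abs_of_pos (Real.exp_pos _)]
    exact Real.exp_lt_one_iff.2 (by linarith)
  unfold boseLog
  convert Real.hasSum_pow_div_log_of_abs_lt_one h using 3 with m
  rw [← Real.exp_nat_mul]
  congr 1
  push_cast
  ring

lemma boseLog_nonneg {x : ℝ} (hx : 0 < x) : 0 ≤ boseLog x :=
  (hasSum_boseLog hx).nonneg fun m => by positivity

lemma boseLog_anti {x y : ℝ} (hx : 0 < x) (hxy : x ≤ y) : boseLog y ≤ boseLog x := by
  unfold boseLog
  have h : 0 < 1 - Real.exp (-x) := by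
    have : Real.exp (-x) < 1 := Real.exp_lt_one_iff.2 (by linarith)
    linarith
  gcongr

lemma boseLog_le {x : ℝ} (hx : 0 < x) : boseLog x ≤ Real.log (1 + 1 / x) := by
  unfold boseLog
  rw [← Real.log_inv]
  have h1 : Real.exp (-x) ≤ 1 / (1 + x) := by
    rw [Real.exp_neg, ← one_div]
    exact one_div_le_one_div_of_le (by linarith) (by linarith [Real.add_one_le_exp x])
  have h2 : x / (1 + x) ≤ 1 - Real.exp (-x) := by
    have : x / (1 + x) = 1 - 1 / (1 + x) := by field_simp; ring
    linarith
  have h3 : 0 < x / (1 + x) := by positivity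
  apply Real.log_le_log (inv_pos.2 (by linarith))
  calc (1 - Real.exp (-x))⁻¹ ≤ (x / (1 + x))⁻¹ := inv_anti₀ h3 h2
    _ = 1 + 1 / x := by field_simp; ring

lemma sum_exp_neg_mul_eq {x : ℝ} (hx : 0 < x) (K : ℕ) :
    ∑ k ∈ Finset.range K, Real.exp (-((k + 1) * x)) =
      (1 - Real.exp (-(K * x))) / (Real.exp x - 1) := by
  have h1 : 0 < Real.exp x - 1 := by linarith [Real.add_one_le_exp x]
  rw [eq_div_iff h1.ne']
  induction K with
  | zero => simp
  | succ K ih =>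
    rw [Finset.sum_range_succ, add_mul, ih]
    have : Real.exp (-((K + 1) * x)) * Real.exp x = Real.exp (-(K * x)) := by
      rw [← Real.exp_add]; congr 1; ring
    push_cast
    linear_combination this

lemma sum_exp_neg_mul_le {x : ℝ} (hx : 0 < x) (K : ℕ) :
    ∑ k ∈ Finset.range K, Real.exp (-((k + 1) * x)) ≤ 1 / x := by
  rw [sum_exp_neg_mul_eq hx]
  have := Real.add_one_le_exp x
  have h2 := Real.exp_pos (-(K * x))
  apply div_le_div₀ <;> linarith

lemma hasSum_one_div_succ_sq :
    HasSum (fun m : ℕ => 1 / ((m : ℝ) + 1) ^ 2) (π ^ 2 / 6) := by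
  have h := (hasSum_nat_add_iff' 1).2 hasSum_zeta_two
  simpa using h

lemma sum_boseLog_le {y : ℝ} (hy : 0 < y) (K : ℕ) :
    ∑ k ∈ Finset.range K, boseLog ((k + 1) * y) ≤ π ^ 2 / 6 / y := by
  have h1 : HasSum (fun m : ℕ => ∑ k ∈ Finset.range K,
      Real.exp (-(((m : ℝ) + 1) * (((k : ℝ) + 1) * y))) / (m + 1))
      (∑ k ∈ Finset.range K, boseLog ((k + 1) * y)) :=
    hasSum_sum fun k _ => hasSum_boseLog (by positivity)
  refine hasSum_le (fun m => ?_) h1 (hasSum_one_div_succ_sq.div_const y)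
  rw [← Finset.sum_div]
  have h2 := sum_exp_neg_mul_le (x := ((m : ℝ) + 1) * y) (by positivity) K
  calc _ = (∑ k ∈ Finset.range K, Real.exp (-((k + 1) * (((m : ℝ) + 1) * y)))) / (m + 1) := by
        congr 1; refine Finset.sum_congr rfl fun k _ => ?_; congr 1; ring
    _ ≤ (1 / (((m : ℝ) + 1) * y)) / (m + 1) := by gcongr
    _ = _ := by field_simp

lemma summable_boseLog {a : ℕ → ℝ} {c : ℝ} (hc : 0 < c) (ha : ∀ k : ℕ, (k + 1) * c ≤ a k) :
    Summable fun k => boseLog (a k) := by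
  have h1 : ∀ k : ℕ, 0 < (k + 1) * c := fun k => by positivity
  refine Summable.of_nonneg_of_le (fun k => boseLog_nonneg ((h1 k).trans_le (ha k)))
    (fun k => boseLog_anti (h1 k) (ha k)) ?_
  exact summable_of_sum_range_le (fun k => boseLog_nonneg (h1 k)) (sum_boseLog_le hc)

lemma tendsto_log_one_div_nhdsGT_zero :
    Tendsto (fun s : ℝ => Real.log (1 / s)) (nhdsWithin 0 (Set.Ioi 0)) atTop := by
  simp only [one_div]
  exact Real.tendsto_log_atTop.comp tendsto_inv_nhdsGT_zero

lemma tendsto_mul_log_one_div_nhdsGT_zero :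
    Tendsto (fun s : ℝ => s * Real.log (1 / s)) (nhdsWithin 0 (Set.Ioi 0)) (nhds 0) := by
  have h := (tendsto_log_mul_rpow_nhdsGT_zero (r := 1) one_pos).neg
  simp only [Real.rpow_one, neg_zero] at h
  refine h.congr fun s => ?_
  rw [one_div, Real.log_inv]; ring

lemma tendsto_rpow_mul_boseLog {ε c : ℝ} (hε : 0 < ε) (hc : 0 < c) :
    Tendsto (fun s : ℝ => s * Real.log (1 / s) * (s ^ (-(1 - ε)) * boseLog (s * c)))
      (nhdsWithin 0 (Set.Ioi 0)) (nhds 0) := by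
  have h0 : Tendsto (fun s : ℝ => Real.log (1 / s) * s ^ (ε / 2))
      (nhdsWithin 0 (Set.Ioi 0)) (nhds 0) := by
    have h := (tendsto_log_mul_rpow_nhdsGT_zero (half_pos hε)).neg
    rw [neg_zero] at h
    refine h.congr fun s => ?_
    rw [one_div, Real.log_inv]; ring
  have h1 : Tendsto (fun s : ℝ => s ^ (ε / 2)) (nhdsWithin 0 (Set.Ioi 0)) (nhds 0) := by
    have := (Real.continuousAt_rpow_const 0 (ε / 2) (Or.inr (half_pos hε).le)).tendsto
    rw [Real.zero_rpow (half_pos hε).ne'] at this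
    exact this.mono_left nhdsWithin_le_nhds
  have h2 : Tendsto (fun s : ℝ => (Real.log (1 / s) * s ^ (ε / 2)) *
      (Real.log (1 + 1 / c) * s ^ (ε / 2) + Real.log (1 / s) * s ^ (ε / 2)))
      (nhdsWithin 0 (Set.Ioi 0)) (nhds 0) := by
    simpa using h0.mul ((h1.const_mul (Real.log (1 + 1 / c))).add h0)
  have hpos : ∀ᶠ s : ℝ in nhdsWithin 0 (Set.Ioi 0), 0 < s ∧ s < 1 :=
    Ioo_mem_nhdsGT one_pos
  refine squeeze_zero' ?_ ?_ h2
  · filter_upwards [hpos] with s ⟨hs, hs1⟩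
    have h3 : 0 ≤ Real.log (1 / s) := Real.log_nonneg (by rw [le_div_iff₀ hs]; linarith)
    have h4 := boseLog_nonneg (mul_pos hs hc)
    positivity
  · filter_upwards [hpos] with s ⟨hs, hs1⟩
    have h3 : 0 ≤ Real.log (1 / s) := Real.log_nonneg (by rw [le_div_iff₀ hs]; linarith)
    have h4 : boseLog (s * c) ≤ Real.log (1 + 1 / c) + Real.log (1 / s) := by
      refine (boseLog_le (mul_pos hs hc)).trans ?_
      rw [← Real.log_mul (by positivity) (by positivity)]
      refine Real.log_le_log (by positivity) ?_
      have : 1 ≤ 1 / s := by rw [le_div_iff₀ hs]; linarith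
      calc 1 + 1 / (s * c) ≤ 1 / s + 1 / (s * c) := by linarith
        _ = _ := by field_simp
    have h5 : s * s ^ (-(1 - ε)) = s ^ (ε / 2) * s ^ (ε / 2) := by
      rw [← Real.rpow_add hs]
      nth_rewrite 1 [← Real.rpow_one s]
      rw [← Real.rpow_add hs]
      congr 1; ring
    calc s * Real.log (1 / s) * (s ^ (-(1 - ε)) * boseLog (s * c))
        ≤ s * Real.log (1 / s) * (s ^ (-(1 - ε)) *
          (Real.log (1 + 1 / c) + Real.log (1 / s))) := by gcongr
      _ = (s * s ^ (-(1 - ε))) * Real.log (1 / s) *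
          (Real.log (1 + 1 / c) + Real.log (1 / s)) := by ring
      _ = _ := by rw [h5]; ring

/-- Upper half of the asymptotics of `∑ boseLog (s L_k)` when `L_k` is at least about `k log k`. -/
lemma eventually_tsum_boseLog_lt {L : ℕ → ℝ} {c : ℝ} (hc : 0 < c) (hL : ∀ k : ℕ, k * c ≤ L k)
    (hlow : ∀ ε > 0, ∀ᶠ k : ℕ in atTop, (1 - ε) * (k * Real.log k) ≤ L k)
    {b : ℝ} (hb : π ^ 2 / 6 < b) :
    ∀ᶠ s : ℝ in nhdsWithin 0 (Set.Ioi 0),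
      s * Real.log (1 / s) * ∑' k : ℕ, boseLog (s * L (k + 1)) < b := by
  obtain ⟨ε, ⟨hε0, hε1⟩, hεb⟩ : ∃ ε : ℝ, (0 < ε ∧ ε < 1) ∧ π ^ 2 / 6 / (1 - ε) ^ 2 < b := by
    have h : Tendsto (fun ε : ℝ => π ^ 2 / 6 / (1 - ε) ^ 2) (nhdsWithin 0 (Set.Ioi 0))
        (nhds (π ^ 2 / 6 / (1 - 0) ^ 2)) := by
      refine Tendsto.mono_left ?_ nhdsWithin_le_nhds
      exact ContinuousAt.tendsto (by fun_prop (disch := norm_num))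
    have h' := h.eventually_lt_const (u := b) (by simpa using hb)
    have hpos : ∀ᶠ s : ℝ in nhdsWithin 0 (Set.Ioi 0), 0 < s ∧ s < 1 :=
      Ioo_mem_nhdsGT one_pos
    exact (hpos.and h').exists
  obtain ⟨k₀, hk₀⟩ := eventually_atTop.1 (hlow ε hε0)
  have hT : Tendsto (fun s : ℝ => s ^ (-(1 - ε))) (nhdsWithin 0 (Set.Ioi 0)) atTop :=
    tendsto_rpow_neg_nhdsGT_zero (by linarith)
  have hpos : ∀ᶠ s : ℝ in nhdsWithin 0 (Set.Ioi 0), 0 < s ∧ s < 1 :=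
    Ioo_mem_nhdsGT one_pos
  have herr := (tendsto_rpow_mul_boseLog hε0 hc).eventually_lt_const
    (u := b - π ^ 2 / 6 / (1 - ε) ^ 2) (by linarith)
  filter_upwards [hpos, hT.eventually_ge_atTop (k₀ : ℝ), herr] with s ⟨hs, hs1⟩ hsT hserr
  have hlog : 0 < Real.log (1 / s) := Real.log_pos (by rw [lt_div_iff₀ hs]; linarith)
  have h1ε : 0 < 1 - ε := by linarith
  set T := s ^ (-(1 - ε)) with hTdef
  have hTpos : 0 < T := Real.rpow_pos_of_pos hs _
  have hsc := boseLog_nonneg (mul_pos hs hc)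
  set y := (1 - ε) ^ 2 * (s * Real.log (1 / s)) with hy
  have hypos : 0 < y := by positivity
  have hterm : ∀ k : ℕ, boseLog (s * L (k + 1)) ≤
      boseLog ((k + 1) * y) + if (k : ℝ) + 1 < T then boseLog (s * c) else 0 := by
    intro k
    have hLk := hL (k + 1)
    push_cast at hLk
    split_ifs with hkT
    · have h1 : s * c ≤ s * L (k + 1) := by
        gcongr
        nlinarith [(Nat.cast_nonneg k : (0 : ℝ) ≤ k)]
      have h2 := boseLog_anti (mul_pos hs hc) h1
      have h3 := boseLog_nonneg (x := (k + 1) * y) (by positivity)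
      linarith
    · rw [add_zero]
      refine boseLog_anti (by positivity) ?_
      push Not at hkT
      have hk : k₀ ≤ k + 1 := by exact_mod_cast hsT.trans hkT
      have h1 := hk₀ (k + 1) hk
      push_cast at h1
      have h2 : (1 - ε) * Real.log (1 / s) ≤ Real.log ((k : ℝ) + 1) := by
        have := Real.log_le_log hTpos hkT
        rw [hTdef, Real.log_rpow hs] at this
        rw [one_div, Real.log_inv]
        linarith
      calc ((k : ℝ) + 1) * y
          = s * ((1 - ε) * ((k + 1) * ((1 - ε) * Real.log (1 / s)))) := by rw [hy]; ring
        _ ≤ s * ((1 - ε) * ((k + 1) * Real.log ((k : ℝ) + 1))) := by gcongr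
        _ ≤ s * L (k + 1) := by gcongr
  have hLnn : ∀ k : ℕ, 0 < s * L (k + 1) := fun k => by
    have hLk := hL (k + 1)
    push_cast at hLk
    have : 0 < ((k : ℝ) + 1) * c := by positivity
    exact mul_pos hs (this.trans_le hLk)
  have hsum : ∑' k : ℕ, boseLog (s * L (k + 1)) ≤ π ^ 2 / 6 / y + T * boseLog (s * c) := by
    refine Real.tsum_le_of_sum_range_le (fun k => boseLog_nonneg (hLnn k)) fun K => ?_
    refine (Finset.sum_le_sum fun k _ => hterm k).trans ?_
    rw [Finset.sum_add_distrib]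
    refine add_le_add (sum_boseLog_le hypos K) ?_
    rw [← Finset.sum_filter, Finset.sum_const, nsmul_eq_mul]
    gcongr
    have hsub : (Finset.range K).filter (fun k : ℕ => (k : ℝ) + 1 < T) ⊆
        Finset.range ⌊T⌋₊ := by
      intro k hk
      rw [Finset.mem_filter] at hk
      rw [Finset.mem_range]
      exact Nat.lt_of_succ_le (Nat.le_floor (by push_cast; exact hk.2.le))
    have := Finset.card_le_card hsub
    rw [Finset.card_range] at this
    exact (Nat.cast_le.2 this).trans (Nat.floor_le hTpos.le)
  have hmain : s * Real.log (1 / s) * (π ^ 2 / 6 / y) = π ^ 2 / 6 / (1 - ε) ^ 2 := by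
    rw [hy]; field_simp
  calc s * Real.log (1 / s) * ∑' k : ℕ, boseLog (s * L (k + 1))
      ≤ s * Real.log (1 / s) * (π ^ 2 / 6 / y + T * boseLog (s * c)) := by gcongr
    _ = π ^ 2 / 6 / (1 - ε) ^ 2 + s * Real.log (1 / s) * (T * boseLog (s * c)) := by
        rw [mul_add, hmain]
    _ < b := by linarith

lemma tendsto_div_exp_sub_one :
    Tendsto (fun x : ℝ => x / (Real.exp x - 1)) (nhdsWithin 0 (Set.Ioi 0)) (nhds 1) := by
  have h := (Real.hasDerivAt_exp 0).tendsto_slope_zero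
  have h' := (h.inv₀ (by simp)).mono_left
    (nhdsWithin_mono (0 : ℝ) fun x (hx : 0 < x) => hx.ne')
  simp only [zero_add, Real.exp_zero, inv_one] at h'
  refine h'.congr fun x => ?_
  rw [smul_eq_mul, mul_inv, inv_inv, div_eq_mul_inv]

lemma tendsto_mul_sum_exp_neg_mul {l : Filter ℝ} {x : ℝ → ℝ} {K : ℝ → ℕ}
    (hx : Tendsto x l (nhdsWithin 0 (Set.Ioi 0)))
    (hK : Tendsto (fun s => K s * x s) l atTop) :
    Tendsto (fun s => x s * ∑ k ∈ Finset.range (K s), Real.exp (-((k + 1) * x s)))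
      l (nhds 1) := by
  have h1 := tendsto_div_exp_sub_one.comp hx
  have h2 : Tendsto (fun s => 1 - Real.exp (-(K s * x s))) l (nhds 1) := by
    simpa using (Real.tendsto_exp_neg_atTop_nhds_zero.comp hK).const_sub 1
  have h3 := h1.mul h2
  rw [one_mul] at h3
  refine h3.congr' ?_
  filter_upwards [hx.eventually self_mem_nhdsWithin] with s hs
  rw [sum_exp_neg_mul_eq hs]
  simp only [Function.comp]
  ring

/-- Lower half of the asymptotics of `∑ boseLog (s L_k)` when `L_k` is at most about `k log k`. -/
lemma eventually_lt_tsum_boseLog {L : ℕ → ℝ} {c : ℝ} (hc : 0 < c) (hL : ∀ k : ℕ, k * c ≤ L k)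
    (hupp : ∀ ε > 0, ∀ᶠ k : ℕ in atTop, L k ≤ (1 + ε) * (k * Real.log k))
    {a : ℝ} (ha : a < π ^ 2 / 6) :
    ∀ᶠ s : ℝ in nhdsWithin 0 (Set.Ioi 0),
      a < s * Real.log (1 / s) * ∑' k : ℕ, boseLog (s * L (k + 1)) := by
  obtain ⟨M, hM⟩ := (hasSum_one_div_succ_sq.tendsto_sum_nat.eventually_const_lt ha).exists
  set S := ∑ m ∈ Finset.range M, 1 / ((m : ℝ) + 1) ^ 2 with hS
  obtain ⟨ε, hε, hεa⟩ : ∃ ε : ℝ, 0 < ε ∧ a < S / (1 + ε) := by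
    have h : Tendsto (fun ε : ℝ => S / (1 + ε)) (nhdsWithin 0 (Set.Ioi 0))
        (nhds (S / (1 + 0))) := by
      refine Tendsto.mono_left ?_ nhdsWithin_le_nhds
      exact ContinuousAt.tendsto (by fun_prop (disch := norm_num))
    have h' := h.eventually_const_lt (u := a) (by simpa using hM)
    exact ((eventually_mem_nhdsWithin (s := Set.Ioi (0 : ℝ))).and h').exists
  have hpos : ∀ᶠ s : ℝ in nhdsWithin 0 (Set.Ioi 0), 0 < s ∧ s < 1 / 2 :=
    Ioo_mem_nhdsGT (by norm_num)
  have hfloor : ∀ s : ℝ, 0 < s ∧ s < 1 / 2 → 1 / (2 * s) ≤ (⌊1 / s⌋₊ : ℝ) := by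
    rintro s ⟨hs, hs1⟩
    have h1 := Nat.lt_floor_add_one (1 / s)
    have h2 : 1 / s = 2 * (1 / (2 * s)) := by field_simp
    have h3 : 1 ≤ 1 / (2 * s) := by rw [le_div_iff₀ (by positivity)]; linarith
    linarith
  have hlim : Tendsto (fun s : ℝ => ∑ m ∈ Finset.range M, (1 / ((m : ℝ) + 1) ^ 2 / (1 + ε) *
      ((((m : ℝ) + 1) * ((1 + ε) * (s * Real.log (1 / s)))) *
        ∑ k ∈ Finset.range ⌊1 / s⌋₊,
          Real.exp (-((k + 1) * (((m : ℝ) + 1) * ((1 + ε) * (s * Real.log (1 / s)))))))))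
      (nhdsWithin 0 (Set.Ioi 0)) (nhds (S / (1 + ε))) := by
    rw [hS, Finset.sum_div]
    refine tendsto_finsetSum _ fun m _ => ?_
    have hx0 : Tendsto (fun s : ℝ => ((m : ℝ) + 1) * ((1 + ε) * (s * Real.log (1 / s))))
        (nhdsWithin 0 (Set.Ioi 0)) (nhdsWithin 0 (Set.Ioi 0)) := by
      refine tendsto_nhdsWithin_iff.2 ⟨?_, ?_⟩
      · simpa using (tendsto_mul_log_one_div_nhdsGT_zero.const_mul (1 + ε)).const_mul ((m : ℝ) + 1)
      · filter_upwards [hpos] with s ⟨hs, hs1⟩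
        have hlog : 0 < Real.log (1 / s) := Real.log_pos (by rw [lt_div_iff₀ hs]; linarith)
        simp only [Set.mem_Ioi]
        positivity
    have hKx : Tendsto (fun s : ℝ => (⌊1 / s⌋₊ : ℝ) *
        (((m : ℝ) + 1) * ((1 + ε) * (s * Real.log (1 / s)))))
        (nhdsWithin 0 (Set.Ioi 0)) atTop := by
      refine tendsto_atTop_mono' _ ?_
        (tendsto_log_one_div_nhdsGT_zero.const_mul_atTop
          (show (0 : ℝ) < ((m : ℝ) + 1) * (1 + ε) / 2 by positivity))
      filter_upwards [hpos] with s hs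
      have hlog : 0 < Real.log (1 / s) :=
        Real.log_pos (by rw [lt_div_iff₀ hs.1]; linarith [hs.2])
      have h0 := hs.1
      calc ((m : ℝ) + 1) * (1 + ε) / 2 * Real.log (1 / s)
          = 1 / (2 * s) * (((m : ℝ) + 1) * ((1 + ε) * (s * Real.log (1 / s)))) := by field_simp
        _ ≤ _ := by gcongr; exact hfloor s hs
    have h := (tendsto_mul_sum_exp_neg_mul hx0 hKx).const_mul (1 / ((m : ℝ) + 1) ^ 2 / (1 + ε))
    rwa [mul_one] at h
  obtain ⟨k₀, hk₀⟩ := eventually_atTop.1 (hupp ε hε)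
  filter_upwards [hpos, hlim.eventually_const_lt hεa,
    tendsto_log_one_div_nhdsGT_zero.eventually_ge_atTop (∑ k ∈ Finset.range k₀, |L k|)]
    with s ⟨hs, hs1⟩ hlt hB
  refine hlt.trans_le ?_
  have hlog : 0 < Real.log (1 / s) := Real.log_pos (by rw [lt_div_iff₀ hs]; linarith)
  set y := (1 + ε) * (s * Real.log (1 / s)) with hy
  have hypos : 0 < y := by positivity
  have hLlow : ∀ k : ℕ, ((k : ℝ) + 1) * (s * c) ≤ s * L (k + 1) := fun k => by
    have hLk := hL (k + 1)
    push_cast at hLk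
    calc ((k : ℝ) + 1) * (s * c) = s * ((k + 1) * c) := by ring
      _ ≤ _ := by gcongr
  have hLpos : ∀ k : ℕ, 0 < s * L (k + 1) := fun k =>
    lt_of_lt_of_le (by positivity) (hLlow k)
  have hterm : ∀ k ∈ Finset.range ⌊1 / s⌋₊, s * L (k + 1) ≤ (k + 1) * y := by
    intro k hk
    have hk1 : ((k : ℝ) + 1) ≤ 1 / s := by
      have := Nat.floor_le (one_div_pos.2 hs).le
      have h' : ((k + 1 : ℕ) : ℝ) ≤ ⌊1 / s⌋₊ := by exact_mod_cast Finset.mem_range.1 hk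
      push_cast at h'
      linarith
    have hk0 : (0 : ℝ) ≤ k := Nat.cast_nonneg k
    have hLk : L (k + 1) ≤ (1 + ε) * ((k + 1) * Real.log (1 / s)) := by
      rcases lt_or_ge (k + 1) k₀ with h | h
      · have h1 : |L (k + 1)| ≤ ∑ k ∈ Finset.range k₀, |L k| :=
          Finset.single_le_sum (f := fun k => |L k|) (fun _ _ => abs_nonneg _)
            (Finset.mem_range.2 h)
        have h2 := le_abs_self (L (k + 1))
        have h3 : 1 * Real.log (1 / s) ≤ ((1 + ε) * (k + 1)) * Real.log (1 / s) := by
          gcongr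
          nlinarith
        linarith
      · have h1 := hk₀ _ h
        push_cast at h1
        refine h1.trans ?_
        gcongr
    calc s * L (k + 1) ≤ s * ((1 + ε) * ((k + 1) * Real.log (1 / s))) := by gcongr
      _ = _ := by rw [hy]; ring
  have hsummable : Summable fun k : ℕ => boseLog (s * L (k + 1)) :=
    summable_boseLog (mul_pos hs hc) hLlow
  have h1 : ∑ k ∈ Finset.range ⌊1 / s⌋₊, boseLog ((k + 1) * y) ≤
      ∑' k : ℕ, boseLog (s * L (k + 1)) :=
    (Finset.sum_le_sum fun k hk => boseLog_anti (hLpos k) (hterm k hk)).trans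
      (hsummable.sum_le_tsum _ fun k _ => boseLog_nonneg (hLpos k))
  have h2 : ∑ k ∈ Finset.range ⌊1 / s⌋₊, ∑ m ∈ Finset.range M,
      Real.exp (-(((m : ℝ) + 1) * (((k : ℝ) + 1) * y))) / (m + 1) ≤
      ∑ k ∈ Finset.range ⌊1 / s⌋₊, boseLog ((k + 1) * y) :=
    Finset.sum_le_sum fun k _ =>
      sum_le_hasSum _ (fun m _ => by positivity) (hasSum_boseLog (by positivity))
  refine le_trans (le_of_eq ?_) (mul_le_mul_of_nonneg_left (h2.trans h1) (by positivity))
  rw [Finset.sum_comm, Finset.mul_sum]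
  refine Finset.sum_congr rfl fun m _ => ?_
  rw [← Finset.sum_div]
  have h3 : ∑ k ∈ Finset.range ⌊1 / s⌋₊, Real.exp (-(((m : ℝ) + 1) * (((k : ℝ) + 1) * y))) =
      ∑ k ∈ Finset.range ⌊1 / s⌋₊, Real.exp (-(((k : ℝ) + 1) * (((m : ℝ) + 1) * y))) :=
    Finset.sum_congr rfl fun k _ => by congr 1; ring
  rw [h3]
  generalize ∑ k ∈ Finset.range ⌊1 / s⌋₊, Real.exp (-(((k : ℝ) + 1) * (((m : ℝ) + 1) * y))) = Z
  rw [hy]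
  field_simp

/-- If `L_k ∼ k log k`, then `∑ -log (1 - exp (-s L_k)) ∼ (π² / 6) / (s log (1 / s))`. -/
lemma tendsto_tsum_boseLog {L : ℕ → ℝ} {c : ℝ} (hc : 0 < c) (hL : ∀ k : ℕ, k * c ≤ L k)
    (hlow : ∀ ε > 0, ∀ᶠ k : ℕ in atTop, (1 - ε) * (k * Real.log k) ≤ L k)
    (hupp : ∀ ε > 0, ∀ᶠ k : ℕ in atTop, L k ≤ (1 + ε) * (k * Real.log k)) :
    Tendsto (fun s : ℝ => s * Real.log (1 / s) * ∑' k : ℕ, boseLog (s * L (k + 1)))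
      (nhdsWithin 0 (Set.Ioi 0)) (nhds (π ^ 2 / 6)) :=
  tendsto_order.2 ⟨fun _ ha => eventually_lt_tsum_boseLog hc hL hupp ha,
    fun _ hb => eventually_tsum_boseLog_lt hc hL hlow hb⟩

/-! ### A Tauberian theorem for Dirichlet-type series -/

section Tauberian

variable {ι : Type*} {u : ι → ℝ}

lemma finite_setOf_le_of_summable_exp (hs : ∀ s > 0, Summable fun i => Real.exp (-(s * u i)))
    (x : ℝ) : {i | u i ≤ x}.Finite := by
  have h := (hs 1 one_pos).tendsto_cofinite_zero.eventually_lt_const (Real.exp_pos (-x))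
  refine Set.Finite.subset h fun i (hi : u i ≤ x) => ?_
  simp [hi]

lemma ncard_setOf_le_le (hs : ∀ s > 0, Summable fun i => Real.exp (-(s * u i)))
    {s : ℝ} (hs0 : 0 < s) (x : ℝ) :
    ({i | u i ≤ x}.ncard : ℝ) ≤ Real.exp (s * x) * ∑' i, Real.exp (-(s * u i)) := by
  have hfin := finite_setOf_le_of_summable_exp hs x
  rw [Set.ncard_eq_toFinset_card _ hfin]
  have h1 : (hfin.toFinset.card : ℝ) * Real.exp (-(s * x)) ≤ ∑' i, Real.exp (-(s * u i)) := by
    rw [← nsmul_eq_mul, ← Finset.sum_const]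
    refine (Finset.sum_le_sum fun i hi => ?_).trans
      ((hs s hs0).sum_le_tsum hfin.toFinset fun i _ => (Real.exp_pos _).le)
    have : u i ≤ x := by simpa using hi
    gcongr
  calc (hfin.toFinset.card : ℝ)
      = Real.exp (s * x) * (hfin.toFinset.card * Real.exp (-(s * x))) := by
        rw [Real.exp_neg]; field_simp
    _ ≤ _ := by gcongr

lemma tsum_exp_le_ncard_add (hs : ∀ s > 0, Summable fun i => Real.exp (-(s * u i)))
    {p q r : ℝ} (hp : 0 < p) (hpq : p ≤ q) (hqr : q ≤ r) (x z : ℝ) :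
    ∑' i, Real.exp (-(q * u i)) ≤ {i | u i ≤ x}.ncard * Real.exp (-(q * z)) +
      Real.exp (-((q - p) * x)) * (∑' i, Real.exp (-(p * u i))) +
      Real.exp ((r - q) * z) * ∑' i, Real.exp (-(r * u i)) := by
  have hfin := finite_setOf_le_of_summable_exp hs x
  have h1 : HasSum (Set.indicator {i | u i ≤ x} fun _ => Real.exp (-(q * z)))
      ({i | u i ≤ x}.ncard * Real.exp (-(q * z))) := by
    rw [Set.ncard_eq_toFinset_card _ hfin, ← nsmul_eq_mul, ← Finset.sum_const]
    have h2 : ∑ i ∈ hfin.toFinset, Real.exp (-(q * z)) = ∑ i ∈ hfin.toFinset,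
        Set.indicator {i | u i ≤ x} (fun _ => Real.exp (-(q * z))) i := by
      refine Finset.sum_congr rfl fun i hi => ?_
      rw [Set.indicator_of_mem (by simpa using hi)]
    rw [h2]
    exact hasSum_sum_of_ne_finset_zero fun i hi => Set.indicator_of_notMem (by simpa using hi) _
  refine hasSum_le (fun i => ?_) (hs q (hp.trans_le hpq)).hasSum
    ((h1.add ((hs p hp).hasSum.mul_left _)).add
      ((hs r (hp.trans_le (hpq.trans hqr))).hasSum.mul_left _))
  rw [← Real.exp_add, ← Real.exp_add]
  have e1 := Real.exp_pos (-((q - p) * x) + -(p * u i))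
  have e2 := Real.exp_pos ((r - q) * z + -(r * u i))
  by_cases hx : u i ≤ x
  · rw [Set.indicator_of_mem (by simpa using hx)]
    rcases le_total z (u i) with hz | hz
    · have : Real.exp (-(q * u i)) ≤ Real.exp (-(q * z)) := by
        have := hp.trans_le hpq
        gcongr
      linarith
    · have : Real.exp (-(q * u i)) ≤ Real.exp ((r - q) * z + -(r * u i)) := by
        apply Real.exp_le_exp.2
        nlinarith
      linarith [Real.exp_pos (-(q * z))]
  · rw [Set.indicator_of_notMem (by simpa using hx)]
    have : Real.exp (-(q * u i)) ≤ Real.exp (-((q - p) * x) + -(p * u i)) := by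
      apply Real.exp_le_exp.2
      nlinarith
    linarith

lemma tendsto_sqrt_div_log : Tendsto (fun x : ℝ => √(x / Real.log x)) atTop atTop := by
  refine Real.tendsto_sqrt_atTop.comp ?_
  have h : Tendsto (fun x : ℝ => Real.log x / x) atTop (nhdsWithin 0 (Set.Ioi 0)) := by
    refine tendsto_nhdsWithin_iff.2 ⟨Real.isLittleO_log_id_atTop.tendsto_div_nhds_zero, ?_⟩
    filter_upwards [eventually_gt_atTop 1] with x hx
    exact div_pos (Real.log_pos hx) (by linarith)
  refine (tendsto_inv_nhdsGT_zero.comp h).congr fun x => ?_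
  simp

/-- Substitution of the saddle point `s = t c / √(x log x)` into a function which is
asymptotic to `A / (s log (1 / s))`, where `c ^ 2 = 2 A`. -/
lemma tendsto_comp_saddle {Λ : ℝ → ℝ} {c t : ℝ} (hc : 0 < c) (ht : 0 < t)
    (hΛ : Tendsto (fun s => s * Real.log (1 / s) * Λ s) (nhdsWithin 0 (Set.Ioi 0))
      (nhds (c ^ 2 / 2))) :
    Tendsto (fun x : ℝ => Λ (t * (c / √(x * Real.log x))) / √(x / Real.log x))
      atTop (nhds (c / t)) := by
  have hsq : Tendsto (fun x : ℝ => √(x * Real.log x)) atTop atTop :=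
    Real.tendsto_sqrt_atTop.comp (tendsto_id.atTop_mul_atTop₀ Real.tendsto_log_atTop)
  have hs0 : Tendsto (fun x : ℝ => t * (c / √(x * Real.log x))) atTop
      (nhdsWithin 0 (Set.Ioi 0)) := by
    refine tendsto_nhdsWithin_iff.2 ⟨?_, ?_⟩
    · simpa using (hsq.const_div_atTop c).const_mul t
    · filter_upwards [hsq.eventually_gt_atTop 0] with x hx
      simp only [Set.mem_Ioi]
      positivity
  have hlog : Tendsto (fun x : ℝ => Real.log (1 / (t * (c / √(x * Real.log x)))) / Real.log x)
      atTop (nhds (1 / 2)) := by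
    have h1 : Tendsto (fun x : ℝ => Real.log (Real.log x) / Real.log x) atTop (nhds 0) :=
      (Real.isLittleO_log_id_atTop.tendsto_div_nhds_zero).comp Real.tendsto_log_atTop
    have h2 : Tendsto (fun x : ℝ => -Real.log (t * c) / Real.log x) atTop (nhds 0) :=
      Real.tendsto_log_atTop.const_div_atTop _
    have h3 : Tendsto (fun x : ℝ => -Real.log (t * c) / Real.log x +
        (1 / 2 + 1 / 2 * (Real.log (Real.log x) / Real.log x))) atTop (nhds (1 / 2)) := by
      simpa only [mul_zero, add_zero, zero_add] using h2.add ((h1.const_mul (1 / 2)).const_add (1 / 2))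
    refine h3.congr' ?_
    filter_upwards [eventually_gt_atTop 1] with x hx
    have hl : 0 < Real.log x := Real.log_pos hx
    have hx0 : 0 < x := by linarith
    have hsx : 0 < √(x * Real.log x) := Real.sqrt_pos.2 (by positivity)
    have : 1 / (t * (c / √(x * Real.log x))) = (t * c)⁻¹ * √(x * Real.log x) := by
      field_simp
    rw [this, Real.log_mul (by positivity) hsx.ne', Real.log_inv, Real.log_sqrt (by positivity),
      Real.log_mul hx0.ne' hl.ne']
    field_simp
  have hmain := (hΛ.comp hs0).div (hlog.const_mul (t * c)) (by positivity)
  have hval : c ^ 2 / 2 / (t * c * (1 / 2)) = c / t := by field_simp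
  rw [hval] at hmain
  refine hmain.congr' ?_
  filter_upwards [eventually_gt_atTop 1, (tendsto_log_one_div_nhdsGT_zero.comp
    hs0).eventually_gt_atTop 0] with x hx hL
  simp only [Function.comp, Pi.div_apply] at hL ⊢
  have hl : 0 < Real.log x := Real.log_pos hx
  have hx0 : 0 < x := by linarith
  set W := Real.log (1 / (t * (c / √(x * Real.log x))))
  rw [Real.sqrt_mul hx0.le, Real.sqrt_div hx0.le]
  have h1 : 0 < √x := Real.sqrt_pos.2 hx0
  have h2 : 0 < √(Real.log x) := Real.sqrt_pos.2 hl
  have h3 : Real.log x = √(Real.log x) * √(Real.log x) := (Real.mul_self_sqrt hl.le).symm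
  generalize Λ (t * (c / (√x * √(Real.log x)))) = V
  generalize √(Real.log x) = b at *
  rw [h3]
  field_simp

/-- If `log ∑ exp (-s u_i) ∼ A / (s log (1 / s))` as `s → 0+`, with `2 A = c ^ 2`, then
`log #{i | u_i ≤ x} ∼ 2 c √(x / log x)` as `x → ∞`. -/
theorem tendsto_log_ncard_div_sqrt (hs : ∀ s > 0, Summable fun i => Real.exp (-(s * u i)))
    {i₀ : ι} (hi₀ : u i₀ = 0) {c : ℝ} (hc : 0 < c)
    (hΛ : Tendsto (fun s => s * Real.log (1 / s) * Real.log (∑' i, Real.exp (-(s * u i))))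
      (nhdsWithin 0 (Set.Ioi 0)) (nhds (c ^ 2 / 2))) :
    Tendsto (fun x : ℝ => Real.log {i | u i ≤ x}.ncard / √(x / Real.log x))
      atTop (nhds (2 * c)) := by
  set F : ℝ → ℝ := fun s => ∑' i, Real.exp (-(s * u i))
  have hFpos : ∀ s > 0, 0 < F s := fun s hs0 =>
    (hs s hs0).tsum_pos (fun i => (Real.exp_pos _).le) i₀ (Real.exp_pos _)
  have hkey : ∀ t > 0, Tendsto (fun x : ℝ => Real.log (F (t * (c / √(x * Real.log x)))) /
      √(x / Real.log x)) atTop (nhds (c / t)) :=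
    fun t ht => tendsto_comp_saddle (Λ := fun s => Real.log (F s)) hc ht hΛ
  have hR := tendsto_sqrt_div_log
  have hσ : ∀ x : ℝ, 1 < x → 0 < c / √(x * Real.log x) ∧
      c / √(x * Real.log x) * x = c * √(x / Real.log x) := by
    intro x hx
    have hl : 0 < Real.log x := Real.log_pos hx
    have hx0 : 0 < x := by linarith
    have h1 : 0 < √x := Real.sqrt_pos.2 hx0
    have h2 : 0 < √(Real.log x) := Real.sqrt_pos.2 hl
    rw [Real.sqrt_mul hx0.le, Real.sqrt_div hx0.le]
    refine ⟨by positivity, ?_⟩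
    calc c / (√x * √(Real.log x)) * x = c / (√x * √(Real.log x)) * (√x * √x) := by
          rw [Real.mul_self_sqrt hx0.le]
      _ = _ := by field_simp
  have hN : ∀ x : ℝ, 1 < x → (1 : ℝ) ≤ {i | u i ≤ x}.ncard := by
    intro x hx
    have : 0 < {i | u i ≤ x}.ncard := by
      rw [Set.ncard_pos (finite_setOf_le_of_summable_exp hs x)]
      exact ⟨i₀, by simp [hi₀]; linarith⟩
    exact_mod_cast this
  refine tendsto_order.2 ⟨fun a ha => ?_, fun b hb => ?_⟩
  · obtain ⟨t, ht1, hta⟩ : ∃ t : ℝ, 1 < t ∧ a < c / t ^ 3 + c / t := by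
      have h : Tendsto (fun t : ℝ => c / t ^ 3 + c / t) (nhdsWithin 1 (Set.Ioi 1))
          (nhds (c / 1 ^ 3 + c / 1)) := by
        refine Tendsto.mono_left ?_ nhdsWithin_le_nhds
        exact ContinuousAt.tendsto (by fun_prop (disch := norm_num))
      have h' := h.eventually_const_lt (u := a) (by simp; linarith)
      exact ((eventually_mem_nhdsWithin (s := Set.Ioi (1 : ℝ))).and h').exists
    have ht0 : 0 < t := by linarith
    have small : ∀ {f : ℝ → ℝ} {e : ℝ}, e < 0 → Tendsto f atTop (nhds e) →
        ∀ᶠ x : ℝ in atTop, Real.exp (√(x / Real.log x) * f x) < 1 / 4 := fun he hf =>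
      (Real.tendsto_exp_atBot.comp (hR.atTop_mul_neg he hf)).eventually_lt_const (by norm_num)
    have hk1 := hkey 1 one_pos
    have hkt := hkey t ht0
    have hkt2 := hkey (t ^ 2) (by positivity)
    have hupper := small (e := -((t - 1) * c) + c / 1 - c / t)
      (by
        have : -((t - 1) * c) + c / 1 - c / t = -(c * (t - 1) ^ 2 / t) := by field_simp; ring
        rw [this, neg_lt_zero]
        have : 0 < t - 1 := by linarith
        positivity)
      ((hk1.const_add (-((t - 1) * c))).sub hkt)
    have hlower := small (e := (t ^ 2 - t) * c / t ^ 4 + c / t ^ 2 - c / t)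
      (by
        have : (t ^ 2 - t) * c / t ^ 4 + c / t ^ 2 - c / t = -(c * (t - 1) ^ 2 / t ^ 3) := by
          field_simp; ring
        rw [this, neg_lt_zero]
        have : 0 < t - 1 := by linarith
        positivity)
      ((hkt2.const_add ((t ^ 2 - t) * c / t ^ 4)).sub hkt)
    have hfin : Tendsto (fun x : ℝ => c / t ^ 3 +
        Real.log (F (t * (c / √(x * Real.log x)))) / √(x / Real.log x) -
        Real.log 2 / √(x / Real.log x)) atTop (nhds (c / t ^ 3 + c / t)) := by
      simpa using (hkt.const_add (c / t ^ 3)).sub (hR.const_div_atTop (Real.log 2))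
    filter_upwards [eventually_gt_atTop 1, hR.eventually_gt_atTop 0, hupper, hlower,
      hfin.eventually_const_lt hta] with x hx hRx hu hl hf
    refine hf.trans_le ?_
    obtain ⟨hσ0, hσx⟩ := hσ x hx
    have hN1 := hN x hx
    set σ := c / √(x * Real.log x)
    set R := √(x / Real.log x)
    set N : ℝ := (({i | u i ≤ x}.ncard : ℕ) : ℝ)
    have hF1 := hFpos (1 * σ) (by positivity)
    have hFt := hFpos (t * σ) (by positivity)
    have hFt2 := hFpos (t ^ 2 * σ) (by positivity)
    have hineq := tsum_exp_le_ncard_add hs (p := 1 * σ) (q := t * σ) (r := t ^ 2 * σ)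
      (by positivity) (by gcongr) (by gcongr; nlinarith) x (x / t ^ 4)
    change F (t * σ) ≤ N * _ + _ * F (1 * σ) + _ * F (t ^ 2 * σ) at hineq
    have e1 : Real.exp (-((t * σ - 1 * σ) * x)) * F (1 * σ) ≤ F (t * σ) / 4 := by
      have h1 : Real.exp (-((t * σ - 1 * σ) * x)) * F (1 * σ) =
          Real.exp (R * (-((t - 1) * c) + Real.log (F (1 * σ)) / R - Real.log (F (t * σ)) / R)) *
            F (t * σ) := by
        have h2 : R * (-((t - 1) * c) + Real.log (F (1 * σ)) / R - Real.log (F (t * σ)) / R) =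
            -((t * σ - 1 * σ) * x) + Real.log (F (1 * σ)) - Real.log (F (t * σ)) := by
          field_simp
          linear_combination (t - 1) * hσx
        rw [h2, Real.exp_sub, Real.exp_add, Real.exp_log hF1, Real.exp_log hFt]
        field_simp
      rw [h1]
      nlinarith
    have e2 : Real.exp ((t ^ 2 * σ - t * σ) * (x / t ^ 4)) * F (t ^ 2 * σ) ≤ F (t * σ) / 4 := by
      have h1 : Real.exp ((t ^ 2 * σ - t * σ) * (x / t ^ 4)) * F (t ^ 2 * σ) =
          Real.exp (R * ((t ^ 2 - t) * c / t ^ 4 + Real.log (F (t ^ 2 * σ)) / R -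
            Real.log (F (t * σ)) / R)) * F (t * σ) := by
        have h2 : R * ((t ^ 2 - t) * c / t ^ 4 + Real.log (F (t ^ 2 * σ)) / R -
            Real.log (F (t * σ)) / R) = (t ^ 2 * σ - t * σ) * (x / t ^ 4) +
            Real.log (F (t ^ 2 * σ)) - Real.log (F (t * σ)) := by
          field_simp
          linear_combination -(t - 1) * hσx
        rw [h2, Real.exp_sub, Real.exp_add, Real.exp_log hFt2, Real.exp_log hFt]
        field_simp
      rw [h1]
      nlinarith
    have e3 : F (t * σ) / 2 ≤ N * Real.exp (-(t * σ * (x / t ^ 4))) := by linarith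
    have e4 := Real.log_le_log (by positivity) e3
    rw [Real.log_div hFt.ne' two_ne_zero, Real.log_mul (by positivity) (Real.exp_ne_zero _),
      Real.log_exp] at e4
    rw [le_div_iff₀ hRx]
    have h5 : (c / t ^ 3 + Real.log (F (t * σ)) / R - Real.log 2 / R) * R =
        t * σ * (x / t ^ 4) + Real.log (F (t * σ)) - Real.log 2 := by
      field_simp
      linear_combination -hσx
    rw [h5]
    linarith
  · have hk1 := (hkey 1 one_pos).const_add c
    filter_upwards [eventually_gt_atTop 1, hR.eventually_gt_atTop 0,
      hk1.eventually_lt_const (u := b) (by simp; linarith)] with x hx hRx hlt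
    refine lt_of_le_of_lt ?_ hlt
    obtain ⟨hσ0, hσx⟩ := hσ x hx
    have hN1 := hN x hx
    rw [one_mul]
    have hF1 := hFpos _ hσ0
    have h1 := Real.log_le_log (by positivity) (ncard_setOf_le_le hs hσ0 x)
    change _ ≤ Real.log (_ * F _) at h1
    rw [Real.log_mul (Real.exp_ne_zero _) hF1.ne', Real.log_exp, hσx] at h1
    rw [div_le_iff₀ hRx, add_mul, div_mul_cancel₀ _ hRx.ne']
    exact h1

end Tauberian

/-! ### The Euler product of `𝒬` -/

lemma nth_prime_injective : Function.Injective (Nat.nth Nat.Prime) :=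
  Nat.nth_injective Nat.infinite_setOfPred_prime

/-- The completely multiplicative map sending the `k`-th prime to `ℓ_k`. It restricts to a
bijection from the positive integers onto `𝒬`. -/
noncomputable def primorialMap (m : ℕ) : ℕ :=
  m.factorization.prod fun p e => ell p.primeCounting ^ e

lemma primorialMap_pos (m : ℕ) : 0 < primorialMap m := by
  unfold primorialMap Finsupp.prod
  exact Finset.prod_pos fun _ _ => pow_pos (ell_pos _) _

lemma primorialMap_one : primorialMap 1 = 1 := by simp [primorialMap]

lemma primorialMap_mul {m n : ℕ} (hm : m ≠ 0) (hn : n ≠ 0) :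
    primorialMap (m * n) = primorialMap m * primorialMap n := by
  unfold primorialMap
  rw [Nat.factorization_mul hm hn]
  exact Finsupp.prod_add_index' (fun _ => pow_zero _) fun _ _ _ => pow_add _ _ _

lemma primorialMap_prime_pow {p : ℕ} (hp : p.Prime) (e : ℕ) :
    primorialMap (p ^ e) = ell p.primeCounting ^ e := by
  unfold primorialMap
  rw [hp.factorization_pow]
  exact Finsupp.prod_single_index (pow_zero _)

lemma primorialMap_prod_nth_prime (t : ℕ) (b : ℕ → ℕ) :
    primorialMap (∏ k ∈ Finset.range t, Nat.nth Nat.Prime k ^ b k) =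
      ∏ k ∈ Finset.range t, ell (k + 1) ^ b k := by
  induction t with
  | zero => simp [primorialMap_one]
  | succ t ih =>
    rw [Finset.prod_range_succ, Finset.prod_range_succ, primorialMap_mul, ih,
      primorialMap_prime_pow (Nat.prime_nth_prime t), primeCounting_nth_prime]
    · exact Finset.prod_ne_zero_iff.2 fun k _ => pow_ne_zero _ (Nat.prime_nth_prime k).ne_zero
    · exact pow_ne_zero _ (Nat.prime_nth_prime t).ne_zero

lemma exists_nth_prime_eq {p : ℕ} (hp : p.Prime) : ∃ k < p, Nat.nth Nat.Prime k = p := by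
  refine ⟨Nat.count Nat.Prime p, ?_, Nat.nth_count hp⟩
  have h := Nat.add_two_le_nth_prime (Nat.count Nat.Prime p)
  rw [Nat.nth_count hp] at h
  omega

lemma primorialMap_eq_prod {m t : ℕ} (hm : m ≠ 0) (hmt : m ≤ t) :
    primorialMap m =
      ∏ k ∈ Finset.range t, ell (k + 1) ^ m.factorization (Nat.nth Nat.Prime k) := by
  unfold primorialMap
  rw [Finsupp.prod_of_support_subset _ (s := (Finset.range t).image (Nat.nth Nat.Prime)) ?_ _
    (fun _ _ => pow_zero _), Finset.prod_image nth_prime_injective.injOn]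
  · simp only [primeCounting_nth_prime]
  · intro p hp
    rw [Nat.support_factorization, Nat.mem_primeFactors] at hp
    obtain ⟨k, hk, rfl⟩ := exists_nth_prime_eq hp.1
    have := Nat.le_of_dvd (Nat.pos_of_ne_zero hm) hp.2.1
    exact Finset.mem_image_of_mem _ (Finset.mem_range.2 (by omega))

lemma factorization_ell_nth_prime (k i : ℕ) :
    (ell k).factorization (Nat.nth Nat.Prime i) = if i < k then 1 else 0 := by
  unfold ell
  rw [Nat.factorization_prod fun j _ => (Nat.prime_nth_prime j).ne_zero, Finsupp.finsetSum_apply]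
  simp only [(Nat.prime_nth_prime _).factorization, Finsupp.single_apply,
    nth_prime_injective.eq_iff, Finset.sum_ite_eq', Finset.mem_range]

lemma factorization_prod_ell_nth_prime (t i : ℕ) (b : ℕ → ℕ) :
    (∏ k ∈ Finset.range t, ell (k + 1) ^ b k).factorization (Nat.nth Nat.Prime i) =
      ∑ k ∈ Finset.Ico i t, b k := by
  rw [Nat.factorization_prod fun j _ => pow_ne_zero _ (ell_pos _).ne', Finsupp.finsetSum_apply]
  simp only [Nat.factorization_pow, Finsupp.smul_apply, factorization_ell_nth_prime, smul_eq_mul,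
    mul_ite, mul_one, mul_zero]
  rw [← Finset.sum_filter]
  refine Finset.sum_congr ?_ fun _ _ => rfl
  ext k
  simp only [Finset.mem_filter, Finset.mem_range, Finset.mem_Ico]
  omega

/-- The numbers `ℓ_1, ℓ_2, …` are multiplicatively independent. -/
lemma eq_of_prod_ell_pow_eq {t : ℕ} {b b' : ℕ → ℕ}
    (h : ∏ k ∈ Finset.range t, ell (k + 1) ^ b k = ∏ k ∈ Finset.range t, ell (k + 1) ^ b' k)
    {i : ℕ} (hi : i < t) : b i = b' i := by
  have hsum : ∀ j, ∑ k ∈ Finset.Ico j t, b k = ∑ k ∈ Finset.Ico j t, b' k := fun j => by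
    rw [← factorization_prod_ell_nth_prime, h, factorization_prod_ell_nth_prime]
  have h1 := hsum i
  rw [Finset.sum_eq_sum_Ico_succ_bot hi, Finset.sum_eq_sum_Ico_succ_bot hi, hsum (i + 1)] at h1
  exact Nat.add_right_cancel h1

lemma primorialMap_injOn : Set.InjOn primorialMap {m | m ≠ 0} := by
  intro m hm n hn h
  refine Nat.eq_of_factorization_eq hm hn fun p => ?_
  by_cases hp : p.Prime
  · obtain ⟨k, hk, rfl⟩ := exists_nth_prime_eq hp
    have hm' := primorialMap_eq_prod hm (show m ≤ m + n + k + 1 by omega)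
    have hn' := primorialMap_eq_prod hn (show n ≤ m + n + k + 1 by omega)
    rw [hm', hn'] at h
    exact eq_of_prod_ell_pow_eq h (show k < m + n + k + 1 by omega)
  · rw [Nat.factorization_eq_zero_of_not_prime _ hp, Nat.factorization_eq_zero_of_not_prime _ hp]

lemma image_primorialMap : primorialMap '' {m | m ≠ 0} = QSet := by
  ext q
  constructor
  · rintro ⟨m, hm, rfl⟩
    exact ⟨m, Nat.one_le_iff_ne_zero.2 hm, _, primorialMap_eq_prod hm le_rfl⟩
  · rintro ⟨t, -, b, rfl⟩
    exact ⟨_, Finset.prod_ne_zero_iff.2 fun k _ => pow_ne_zero _ (Nat.prime_nth_prime k).ne_zero,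
      primorialMap_prod_nth_prime t b⟩

lemma Qfun_eq_ncard {n : ℕ} (hn : 1 ≤ n) :
    Qfun n = {i : {m : ℕ // m ≠ 0} | Real.log (primorialMap i) ≤ Real.log n}.ncard := by
  have hinj : Function.Injective fun i : {m : ℕ // m ≠ 0} => primorialMap i :=
    fun i j h => Subtype.ext (primorialMap_injOn i.2 j.2 h)
  rw [← Set.ncard_image_of_injective _ hinj, Qfun, ← image_primorialMap]
  congr 1
  have hlog : ∀ m : ℕ, Real.log (primorialMap m) ≤ Real.log n ↔ primorialMap m ≤ n := fun m => by
    rw [Real.log_le_log_iff (by exact_mod_cast primorialMap_pos m) (by exact_mod_cast hn)]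
    exact Nat.cast_le
  ext q
  simp only [Set.mem_inter_iff, Set.mem_image, Set.mem_Icc, Set.mem_ofPred_eq, hlog, Subtype.exists]
  constructor
  · rintro ⟨⟨m, hm, rfl⟩, -, h⟩
    exact ⟨m, hm, h, rfl⟩
  · rintro ⟨m, hm, h, rfl⟩
    exact ⟨⟨m, hm, rfl⟩, primorialMap_pos m, h⟩

/-- The completely multiplicative function `m ↦ φ(m) ^ (-s)`, with `φ = primorialMap`. -/
noncomputable def primorialChar (s : ℝ) : ℕ →*₀ ℝ where
  toFun m := if m = 0 then 0 else Real.exp (-(s * Real.log (primorialMap m)))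
  map_zero' := by simp
  map_one' := by simp [primorialMap_one]
  map_mul' m n := by
    rcases eq_or_ne m 0 with rfl | hm
    · simp
    rcases eq_or_ne n 0 with rfl | hn
    · simp
    have h1 : (primorialMap m : ℝ) ≠ 0 := by exact_mod_cast (primorialMap_pos m).ne'
    have h2 : (primorialMap n : ℝ) ≠ 0 := by exact_mod_cast (primorialMap_pos n).ne'
    rw [if_neg (mul_ne_zero hm hn), if_neg hm, if_neg hn, primorialMap_mul hm hn, ← Real.exp_add,
      Nat.cast_mul, Real.log_mul h1 h2]
    congr 1
    ring

lemma primorialChar_apply (s : ℝ) {m : ℕ} (hm : m ≠ 0) :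
    primorialChar s m = Real.exp (-(s * Real.log (primorialMap m))) := if_neg hm

lemma primorialChar_nonneg (s : ℝ) (m : ℕ) : 0 ≤ primorialChar s m := by
  rcases eq_or_ne m 0 with rfl | hm
  · simp
  · rw [primorialChar_apply s hm]; positivity

lemma primorialChar_nth_prime (s : ℝ) (k : ℕ) :
    primorialChar s (Nat.nth Nat.Prime k) = Real.exp (-(s * Real.log (ell (k + 1)))) := by
  have h := primorialMap_prime_pow (Nat.prime_nth_prime k) 1
  rw [pow_one, pow_one, primeCounting_nth_prime] at h
  rw [primorialChar_apply s (Nat.prime_nth_prime k).ne_zero, h]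

lemma log_ell_succ_pos (k : ℕ) : 0 < Real.log (ell (k + 1)) := by
  refine lt_of_lt_of_le ?_ (mul_log_two_le_log_ell (k + 1))
  have := Real.log_pos one_lt_two
  positivity

lemma norm_primorialChar_lt_one {s : ℝ} (hs : 0 < s) {p : ℕ} (hp : p.Prime) :
    ‖primorialChar s p‖ < 1 := by
  obtain ⟨k, -, rfl⟩ := exists_nth_prime_eq hp
  rw [primorialChar_nth_prime, Real.norm_of_nonneg (Real.exp_pos _).le, Real.exp_lt_one_iff,
    neg_lt_zero]
  exact mul_pos hs (log_ell_succ_pos k)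

lemma primesBelow_nth_prime (K : ℕ) :
    (Nat.nth Nat.Prime K).primesBelow = (Finset.range K).image (Nat.nth Nat.Prime) := by
  have hmono := Nat.nth_strictMono Nat.infinite_setOfPred_prime
  ext p
  simp only [Nat.mem_primesBelow, Finset.mem_image, Finset.mem_range]
  constructor
  · rintro ⟨hlt, hp⟩
    obtain ⟨k, -, rfl⟩ := exists_nth_prime_eq hp
    exact ⟨k, hmono.lt_iff_lt.1 hlt, rfl⟩
  · rintro ⟨k, hk, rfl⟩
    exact ⟨hmono hk, Nat.prime_nth_prime k⟩

lemma prod_primesBelow_primorialChar {s : ℝ} (hs : 0 < s) (K : ℕ) :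
    ∏ p ∈ (Nat.nth Nat.Prime K).primesBelow, (1 - primorialChar s p)⁻¹ =
      Real.exp (∑ k ∈ Finset.range K, boseLog (s * Real.log (ell (k + 1)))) := by
  rw [primesBelow_nth_prime, Finset.prod_image nth_prime_injective.injOn, Real.exp_sum]
  refine Finset.prod_congr rfl fun k _ => ?_
  have : Real.exp (-(s * Real.log (ell (k + 1)))) < 1 :=
    Real.exp_lt_one_iff.2 (neg_lt_zero.2 (mul_pos hs (log_ell_succ_pos k)))
  rw [primorialChar_nth_prime, boseLog, Real.exp_neg (Real.log _), Real.exp_log (by linarith)]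

lemma summable_boseLog_log_ell {s : ℝ} (hs : 0 < s) :
    Summable fun k : ℕ => boseLog (s * Real.log (ell (k + 1))) := by
  refine summable_boseLog (mul_pos hs (Real.log_pos one_lt_two)) fun k => ?_
  have h := mul_le_mul_of_nonneg_left (mul_log_two_le_log_ell (k + 1)) hs.le
  push_cast at h
  linarith

lemma summable_primorialChar {s : ℝ} (hs : 0 < s) : Summable (primorialChar s) := by
  refine summable_of_sum_le (c := Real.exp (∑' k : ℕ, boseLog (s * Real.log (ell (k + 1)))))
    (primorialChar_nonneg s) fun S => ?_
  set K := S.sup id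
  have h := (EulerProduct.summable_and_hasSum_smoothNumbers_prod_primesBelow_geometric
    (f := (primorialChar s : ℕ →* ℝ)) (fun hp => norm_primorialChar_lt_one hs hp)
    (Nat.nth Nat.Prime K)).2
  simp only [MonoidHom.coe_coe] at h
  rw [prod_primesBelow_primorialChar hs] at h
  have h' := hasSum_subtype_iff_indicator.1 h
  have hsub : ∑ m ∈ S, primorialChar s m = ∑ m ∈ S,
      Set.indicator (Nat.nth Nat.Prime K).smoothNumbers (primorialChar s) m := by
    refine Finset.sum_congr rfl fun m hm => ?_
    rcases eq_or_ne m 0 with rfl | hm0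
    · simp [Set.indicator]
    rw [Set.indicator_of_mem]
    refine Nat.mem_smoothNumbers.2 ⟨hm0, fun p hp => ?_⟩
    have h1 : m ≤ K := Finset.le_sup (f := id) hm
    have h2 := Nat.le_of_mem_primeFactorsList hp
    have h3 := Nat.add_two_le_nth_prime K
    omega
  rw [hsub]
  refine (sum_le_hasSum S (fun m _ => Set.indicator_nonneg
    (fun m _ => primorialChar_nonneg s m) m) h').trans ?_
  gcongr
  exact (summable_boseLog_log_ell hs).sum_le_tsum _ fun k _ =>
    boseLog_nonneg (mul_pos hs (log_ell_succ_pos k))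

lemma tsum_primorialChar {s : ℝ} (hs : 0 < s) :
    ∑' m, primorialChar s m = Real.exp (∑' k : ℕ, boseLog (s * Real.log (ell (k + 1)))) := by
  have h1 := EulerProduct.eulerProduct_completely_multiplicative (summable_primorialChar hs).norm
  have h2 := h1.comp (Nat.nth_strictMono Nat.infinite_setOfPred_prime).tendsto_atTop
  refine tendsto_nhds_unique h2 ?_
  refine ((Real.continuous_exp.tendsto _).comp
    (summable_boseLog_log_ell hs).hasSum.tendsto_sum_nat).congr fun K => ?_
  exact (prod_primesBelow_primorialChar hs K).symm

lemma hasSum_exp_log_primorialMap {s : ℝ} (hs : 0 < s) :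
    HasSum (fun i : {m : ℕ // m ≠ 0} => Real.exp (-(s * Real.log (primorialMap i))))
      (Real.exp (∑' k : ℕ, boseLog (s * Real.log (ell (k + 1))))) := by
  rw [← tsum_primorialChar hs]
  have h : Function.support (primorialChar s) ⊆ {m | m ≠ 0} := by
    rintro m hm rfl
    simp at hm
  have h2 := (hasSum_subtype_iff_of_support_subset h).2 (summable_primorialChar hs).hasSum
  have h3 : (fun i : {m : ℕ // m ≠ 0} => Real.exp (-(s * Real.log (primorialMap i)))) =
      primorialChar s ∘ Subtype.val := funext fun i => (primorialChar_apply s i.2).symm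
  rw [h3]
  exact h2

/-- Hardy–Ramanujan: `log Q(n) ~ (2π/√3) √(log n / log log n)` as `n → ∞`. -/
theorem hardy_ramanujan_asymptotics :
    Filter.Tendsto
      (fun n : ℕ => Real.log (Qfun n) /
        ((2 * π / Real.sqrt 3) * Real.sqrt (Real.log n / Real.log (Real.log n))))
      Filter.atTop (nhds 1) := by
  have hc : 0 < π / √3 := by positivity
  have hlim := tendsto_tsum_boseLog (L := fun k => Real.log (ell k)) (Real.log_pos one_lt_two)
    mul_log_two_le_log_ell (fun _ => eventually_le_log_ell) (fun _ => eventually_log_ell_le)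
  have hval : π ^ 2 / 6 = (π / √3) ^ 2 / 2 := by
    rw [div_pow, Real.sq_sqrt (by norm_num)]
    ring
  rw [hval] at hlim
  have htaub := tendsto_log_ncard_div_sqrt
    (u := fun i : {m : ℕ // m ≠ 0} => Real.log (primorialMap i))
    (fun s hs => (hasSum_exp_log_primorialMap hs).summable) (i₀ := ⟨1, one_ne_zero⟩)
    (by simp [primorialMap_one]) hc (hlim.congr' (by
      filter_upwards [self_mem_nhdsWithin] with s hs
      rw [(hasSum_exp_log_primorialMap hs).tsum_eq, Real.log_exp]))
  have hn := (htaub.comp (Real.tendsto_log_atTop.comp tendsto_natCast_atTop_atTop)).div_const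
    (2 * π / √3)
  have hone : 2 * (π / √3) / (2 * π / √3) = 1 := by field_simp
  rw [hone] at hn
  refine hn.congr' ?_
  filter_upwards [eventually_ge_atTop 1] with n hn1
  simp only [Function.comp]
  rw [Qfun_eq_ncard hn1, div_div, mul_comm (2 * π / √3)]
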